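/- arXiv:1810.12189 — 11 statements merged into one kernel-verified Lean document; each statement's English description precedes it below -/
import Mathlib

section
/- Let a < b and m, c be real numbers with m a + c > 0 and m b + c > 0. Then the cubic polynomial p(u) = p₀ + p₁u + p₂u² + p₃u³ with p₀ = (2/3)m a³ + c(a² − b²), p₁ = −2c(a−b) − m(a² + b²), p₂ = 2mb, p₃ = −(2/3)m satisfies p(a) < 0 and p(b) > 0, and hence there exists u ∈ (a,b) with p(u) = 0. -/
/-- the AEQ update cubic changes sign on `[a,b]` and hence has a root
in `(a,b)`, when the linear density approximation is positive at the endpoints. -/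
theorem aeq_cubic_root_exists (a b m c : ℝ) (hab : a < b)
    (ha : 0 < m * a + c) (hb : 0 < m * b + c) (p : ℝ → ℝ)
    (hp : ∀ u : ℝ, p u =
      ((2 / 3) * m * a ^ 3 + c * (a ^ 2 - b ^ 2))
        + (-2 * c * (a - b) - m * (a ^ 2 + b ^ 2)) * u
        + (2 * m * b) * u ^ 2 + (-(2 / 3) * m) * u ^ 3) :
    p a < 0 ∧ 0 < p b ∧ ∃ u ∈ Set.Ioo a b, p u = 0 := by
  have hL : 0 < (b - a) ^ 2 := pow_pos (sub_pos.mpr hab) 2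
  have hpa : p a < 0 := by
    have h : p a = -((b - a) ^ 2 * (m * a + c)) := by rw [hp]; ring
    rw [h]
    exact neg_neg_of_pos (mul_pos hL ha)
  have hpb : 0 < p b := by
    have h : p b = (b - a) ^ 2 * ((m * b + c) / 3 + 2 / 3 * (m * a + c)) := by rw [hp]; ring
    rw [h]
    positivity
  have hcont : Continuous p := by
    rw [funext hp]
    fun_prop
  obtain ⟨u, hu, hu0⟩ := intermediate_value_Ioo hab.le hcont.continuousOn ⟨hpa, hpb⟩
  exact ⟨hpa, hpb, u, hu, hu0⟩
end

section
/- Let a < b and m, c be real numbers with m a + c > 0 and m b + c > 0. Then every root u ∈ [a,b] of the cubic polynomial p(u) = p₀ + p₁u + p₂u² + p₃u³ with p₀ = (2/3)m a³ + c(a² − b²), p₁ = −2c(a−b) − m(a² + b²), p₂ = 2mb, p₃ = −(2/3)m lies in the open interval (a,b); equivalently, writing u = θa + (1−θ)b, the convex-combination coefficient satisfies 0 < θ < 1. -/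
/-- every root of the AEQ update cubic in `[a,b]` is interior; equivalently
the convex-combination coefficient `θ` with `u = θa + (1−θ)b` satisfies `0 < θ < 1`. -/
theorem aeq_cubic_root_interior (a b m c : ℝ) (hab : a < b)
    (ha : 0 < m * a + c) (hb : 0 < m * b + c) (p : ℝ → ℝ)
    (hp : ∀ u : ℝ, p u =
      ((2 / 3) * m * a ^ 3 + c * (a ^ 2 - b ^ 2))
        + (-2 * c * (a - b) - m * (a ^ 2 + b ^ 2)) * u
        + (2 * m * b) * u ^ 2 + (-(2 / 3) * m) * u ^ 3) :
    (∀ u ∈ Set.Icc a b, p u = 0 → u ∈ Set.Ioo a b) ∧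
      (∀ θ : ℝ, 0 ≤ θ → θ ≤ 1 → p (θ * a + (1 - θ) * b) = 0 → 0 < θ ∧ θ < 1) := by
  have hsq : 0 < (b - a) ^ 2 := pow_pos (sub_pos.mpr hab) 2
  have hpa : p a ≠ 0 := by
    have h : p a = -((b - a) ^ 2 * (m * a + c)) := by rw [hp]; ring
    rw [h]
    exact neg_ne_zero.mpr (mul_pos hsq ha).ne'
  have hpb : p b ≠ 0 := by
    have h : p b = (b - a) ^ 2 * ((2 / 3) * (m * a + c) + (1 / 3) * (m * b + c)) := by
      rw [hp]; ring
    rw [h]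
    positivity
  refine ⟨fun u hu h => ⟨hu.1.lt_of_ne ?_, hu.2.lt_of_ne ?_⟩,
    fun θ h0 h1 h => ⟨h0.lt_of_ne ?_, h1.lt_of_ne ?_⟩⟩
  · rintro rfl
    exact hpa h
  · rintro rfl
    exact hpb h
  · rintro rfl
    exact hpb (by simpa using h)
  · rintro rfl
    exact hpa (by simpa using h)
end

section
/- Let a < b and m, c be real numbers with m a + c > 0 and m b + c > 0. Then the quadratic polynomial r(u) = r₀ + r₁u + r₂u² with r₀ = −(m/24)(b³ − a³) − (c/8)(b² − a²), r₁ = (c/4)(b−a), r₂ = (m/8)(b−a) satisfies r(a) < 0 and r(b) > 0, and hence there exists u ∈ (a,b) with r(u) = 0. -/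
/-- the interior ALM update quadratic changes sign on `[a,b]` and hence
has a root in `(a,b)`, when the linear density approximation is positive at the endpoints. -/
theorem alm_quadratic_root_exists (a b m c : ℝ) (hab : a < b)
    (ha : 0 < m * a + c) (hb : 0 < m * b + c) (r : ℝ → ℝ)
    (hr : ∀ u : ℝ, r u =
      (-(m / 24) * (b ^ 3 - a ^ 3) - (c / 8) * (b ^ 2 - a ^ 2))
        + ((c / 4) * (b - a)) * u + ((m / 8) * (b - a)) * u ^ 2) :
    r a < 0 ∧ 0 < r b ∧ ∃ u ∈ Set.Ioo a b, r u = 0 := by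
  have hsq : 0 < (b - a) ^ 2 / 24 := by have := sub_pos.2 hab; positivity
  have hra : r a < 0 := by
    have h : r a = -((b - a) ^ 2 / 24 * (2 * (m * a + c) + (m * b + c))) := by
      rw [hr]; ring
    rw [h, neg_lt_zero]
    positivity
  have hrb : 0 < r b := by
    have h : r b = (b - a) ^ 2 / 24 * ((m * a + c) + 2 * (m * b + c)) := by
      rw [hr]; ring
    rw [h]
    positivity
  have hcont : Continuous r := by
    rw [funext hr]
    fun_prop
  exact ⟨hra, hrb, intermediate_value_Ioo hab.le hcont.continuousOn ⟨hra, hrb⟩⟩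
end

section
/- Let a < b and m, c be real numbers with m a + c > 0 and m b + c > 0. Then every root u ∈ [a,b] of the quadratic polynomial r(u) = r₀ + r₁u + r₂u² with r₀ = −(m/24)(b³ − a³) − (c/8)(b² − a²), r₁ = (c/4)(b−a), r₂ = (m/8)(b−a) lies in the open interval (a,b); equivalently, writing u = θa + (1−θ)b, the convex-combination coefficient satisfies 0 < θ < 1. -/
/-- every root of the interior ALM update quadratic in `[a,b]` is interior;
equivalently the convex-combination coefficient `θ` with `u = θa + (1−θ)b` satisfies
`0 < θ < 1`. -/
theorem alm_quadratic_root_interior (a b m c : ℝ) (hab : a < b)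
    (ha : 0 < m * a + c) (hb : 0 < m * b + c) (r : ℝ → ℝ)
    (hr : ∀ u : ℝ, r u =
      (-(m / 24) * (b ^ 3 - a ^ 3) - (c / 8) * (b ^ 2 - a ^ 2))
        + ((c / 4) * (b - a)) * u + ((m / 8) * (b - a)) * u ^ 2) :
    (∀ u ∈ Set.Icc a b, r u = 0 → u ∈ Set.Ioo a b) ∧
      (∀ θ : ℝ, 0 ≤ θ → θ ≤ 1 → r (θ * a + (1 - θ) * b) = 0 → 0 < θ ∧ θ < 1) := by
  have hba : 0 < (b - a) ^ 2 / 24 := by have := sub_pos.2 hab; positivity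
  have r_left : r a ≠ 0 := by
    have h : r a = -((b - a) ^ 2 / 24 * (2 * (m * a + c) + (m * b + c))) := by rw [hr]; ring
    rw [h]
    exact neg_ne_zero.2 (by positivity)
  have r_right : r b ≠ 0 := by
    have h : r b = (b - a) ^ 2 / 24 * ((m * a + c) + 2 * (m * b + c)) := by rw [hr]; ring
    rw [h]
    positivity
  refine ⟨fun u hu h0 => ⟨hu.1.lt_of_ne ?_, hu.2.lt_of_ne ?_⟩,
    fun θ h0 h1 h => ⟨h0.lt_of_ne ?_, h1.lt_of_ne ?_⟩⟩
  · rintro rfl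
    exact r_left h0
  · rintro rfl
    exact r_right h0
  · rintro rfl
    exact r_right (by simpa using h)
  · rintro rfl
    exact r_left (by simpa using h)
end

section
/- Let a < b and m, c be real numbers with (2/3)(m a + c) + (1/3)(m b + c) > 0 (in particular this holds if m a + c > 0 and m b + c > 0). Then the cubic polynomial r(u) = r₀ + r₁u + r₂u² + r₃u³ with r₀ = (m/3)(a³ − b³/8) + (c/2)(a² − b²/4), r₁ = −(m/2)a² + (c/4)b − c a, r₂ = (1/8)m b + (3/8)c, r₃ = m/12 satisfies r(a) < 0 and r(b) > 0, and hence there exists u ∈ (a,b) with r(u) = 0. -/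
/-- the boundary (k = 1) ALM update cubic changes sign on `[a,b]` and hence
has a root in `(a,b)`, when `(2/3)(ma + c) + (1/3)(mb + c) > 0`. -/
theorem alm_boundary_cubic_root_exists (a b m c : ℝ) (hab : a < b)
    (hB : 0 < (2 / 3) * (m * a + c) + (1 / 3) * (m * b + c)) (r : ℝ → ℝ)
    (hr : ∀ u : ℝ, r u =
      ((m / 3) * (a ^ 3 - b ^ 3 / 8) + (c / 2) * (a ^ 2 - b ^ 2 / 4))
        + (-(m / 2) * a ^ 2 + (c / 4) * b - c * a) * u
        + ((1 / 8) * m * b + (3 / 8) * c) * u ^ 2 + (m / 12) * u ^ 3) :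
    r a < 0 ∧ 0 < r b ∧ ∃ u ∈ Set.Ioo a b, r u = 0 := by
  have ha : r a = -((b - a) ^ 2 / 8 * ((2 / 3) * (m * a + c) + (1 / 3) * (m * b + c))) := by
    rw [hr]; ring
  have hb : r b = (b - a) ^ 2 / 2 * ((2 / 3) * (m * a + c) + (1 / 3) * (m * b + c)) := by
    rw [hr]; ring
  have hsq : 0 < (b - a) ^ 2 := pow_pos (sub_pos.2 hab) 2
  have hra : r a < 0 := by
    rw [ha, neg_lt_zero]
    exact mul_pos (by linarith) hB
  have hrb : 0 < r b := by
    rw [hb]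
    exact mul_pos (by linarith) hB
  have hcont : Continuous r := by
    rw [funext hr]
    fun_prop
  exact ⟨hra, hrb, intermediate_value_Ioo hab.le hcont.continuousOn ⟨hra, hrb⟩⟩
end

section
/- Let a < q < b and m, c be real numbers, and define d = 2(b−a)(m(a+b)/2 + c) − 2m(b−q)². Then: (i) if m ≤ 0 and m(a+b)/2 + c > 0, then d > 0; (ii) if m > 0, b − q ≤ q − a, and m a + c > 0, then d ≥ 2(b−a)(m a + c) > 0. -/
/-- the derivative `d` of the AEQ optimality expression is positive
(paper's Appendix C), in the two cases `m ≤ 0` and `m > 0` with `q` at least as close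
to `b` as to `a`. -/
theorem aeq_optimality_derivative_positive (a b q m c : ℝ) (haq : a < q) (hqb : q < b)
    (d : ℝ)
    (hd : d = 2 * (b - a) * (m * ((a + b) / 2) + c) - 2 * m * (b - q) ^ 2) :
    (m ≤ 0 → 0 < m * ((a + b) / 2) + c → 0 < d) ∧
      (0 < m → b - q ≤ q - a → 0 < m * a + c →
        2 * (b - a) * (m * a + c) ≤ d ∧ 0 < 2 * (b - a) * (m * a + c)) := by
  have hab : 0 < b - a := by linarith
  subst hd
  refine ⟨fun hm h => ?_, fun hm hq h => ⟨?_, by positivity⟩⟩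
  · have h₁ : 0 < (b - a) * (m * ((a + b) / 2) + c) := mul_pos hab h
    have h₂ : m * (b - q) ^ 2 ≤ 0 := mul_nonpos_of_nonpos_of_nonneg hm (sq_nonneg _)
    linarith
  · have h₁ : 2 * (b - q) ^ 2 ≤ (b - a) ^ 2 := by nlinarith
    have h₂ : m * (2 * (b - q) ^ 2) ≤ m * (b - a) ^ 2 := mul_le_mul_of_nonneg_left h₁ hm.le
    linarith
end

section
/- Let a ≤ q ≤ b be real numbers, M ≥ 0, let f : ℝ → ℝ be continuous on ℝ and twice differentiable on [a,b] with |f''(x)| ≤ M on [a,b], and let g(x) = f(a) + ((f(b) − f(a))/(b − a))(x − a) be the linear interpolant of f at a and b (assume a < b). Then |∫_a^q 2(q−x)(g(x) − f(x)) dx − (b−q)²(g(q) − f(q))| ≤ (M/4)(b−a)⁴. -/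
open intervalIntegral

/-- A function with second derivative at least `-M` on `[a, b]` exceeds its chord by at most
`M / 2 * (x - a) * (b - x)`. -/
theorem sub_chord_le_of_neg_le_deriv2 {a b M : ℝ} (hab : a < b) {f f' f'' : ℝ → ℝ}
    (hf' : ∀ x ∈ Set.Icc a b, HasDerivWithinAt f (f' x) (Set.Icc a b) x)
    (hf'' : ∀ x ∈ Set.Icc a b, HasDerivWithinAt f' (f'' x) (Set.Icc a b) x)
    (hbd : ∀ x ∈ Set.Icc a b, -M ≤ f'' x) {x : ℝ} (hx : x ∈ Set.Icc a b) :
    f x - (f a + (f b - f a) / (b - a) * (x - a)) ≤ M / 2 * ((x - a) * (b - x)) := by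
  have hba : 0 < b - a := sub_pos.2 hab
  have hconv : ConvexOn ℝ (Set.Icc a b) (fun y => f y + M / 2 * y ^ 2) := by
    refine convexOn_of_hasDerivWithinAt2_nonneg (f' := fun y => f' y + M * y)
      (f'' := fun y => f'' y + M) (convex_Icc a b) ?_ ?_ ?_ ?_
    · exact ContinuousOn.add (fun y hy => (hf' y hy).continuousWithinAt) (by fun_prop)
    · intro y hy
      have h := (hf' y (interior_subset hy)).mono interior_subset
      have h2 := (((hasDerivAt_id y).pow 2).const_mul (M / 2)).hasDerivWithinAt
        (s := interior (Set.Icc a b))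
      exact (h.add h2).congr_deriv (by simp; ring)
    · intro y hy
      have h := (hf'' y (interior_subset hy)).mono interior_subset
      have h2 := ((hasDerivAt_id y).const_mul M).hasDerivWithinAt
        (s := interior (Set.Icc a b))
      exact (h.add h2).congr_deriv (by simp)
    · intro y hy
      linarith [hbd y (interior_subset hy)]
  have h := hconv.2 (Set.left_mem_Icc.2 hab.le) (Set.right_mem_Icc.2 hab.le)
    (div_nonneg (sub_nonneg.2 hx.2) hba.le) (div_nonneg (sub_nonneg.2 hx.1) hba.le)
    (by field_simp; ring)
  have hcomb : (b - x) / (b - a) * a + (x - a) / (b - a) * b = x := by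
    field_simp
    ring
  simp only [smul_eq_mul, hcomb] at h
  have hid : (b - x) / (b - a) * (f a + M / 2 * a ^ 2) + (x - a) / (b - a) * (f b + M / 2 * b ^ 2)
      = f a + (f b - f a) / (b - a) * (x - a) + M / 2 * ((x - a) * (b - x)) + M / 2 * x ^ 2 := by
    field_simp
    ring
  linarith

/-- The error of linear interpolation at the end points of `[a, b]`. -/
theorem abs_chord_sub_le {a b M : ℝ} (hab : a < b) (hM : 0 ≤ M) {f f' f'' : ℝ → ℝ}
    (hf' : ∀ x ∈ Set.Icc a b, HasDerivWithinAt f (f' x) (Set.Icc a b) x)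
    (hf'' : ∀ x ∈ Set.Icc a b, HasDerivWithinAt f' (f'' x) (Set.Icc a b) x)
    (hbd : ∀ x ∈ Set.Icc a b, |f'' x| ≤ M) {x : ℝ} (hx : x ∈ Set.Icc a b) :
    |f a + (f b - f a) / (b - a) * (x - a) - f x| ≤ M / 8 * (b - a) ^ 2 := by
  have hup := sub_chord_le_of_neg_le_deriv2 hab hf' hf'' (fun y hy => (abs_le.1 (hbd y hy)).1) hx
  have hlow := sub_chord_le_of_neg_le_deriv2 (f := fun y => -f y) (f' := fun y => -f' y)
    (f'' := fun y => -f'' y) hab (fun y hy => (hf' y hy).neg) (fun y hy => (hf'' y hy).neg)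
    (fun y hy => neg_le_neg (abs_le.1 (hbd y hy)).2) hx
  have hneg : (-f b - -f a) / (b - a) * (x - a) = -((f b - f a) / (b - a) * (x - a)) := by ring
  rw [hneg] at hlow
  have hquad : M / 2 * ((x - a) * (b - x)) ≤ M / 8 * (b - a) ^ 2 := by
    nlinarith [mul_nonneg hM (sq_nonneg (x - a - (b - x)))]
  exact abs_le.2 ⟨by linarith, by linarith⟩

/-- fourth-order bound on the AEQ optimality-condition offset when the
density `f` (with `|f''| ≤ M` on `[a,b]`) is replaced by its linear interpolant `g`. -/
theorem aeq_offset_fourth_order (a b q M : ℝ) (hab : a < b) (haq : a ≤ q) (hqb : q ≤ b)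
    (hM : 0 ≤ M) (f f' f'' : ℝ → ℝ) (hfc : Continuous f)
    (hf' : ∀ x ∈ Set.Icc a b, HasDerivWithinAt f (f' x) (Set.Icc a b) x)
    (hf'' : ∀ x ∈ Set.Icc a b, HasDerivWithinAt f' (f'' x) (Set.Icc a b) x)
    (hbd : ∀ x ∈ Set.Icc a b, |f'' x| ≤ M)
    (g : ℝ → ℝ)
    (hg : ∀ x : ℝ, g x = f a + ((f b - f a) / (b - a)) * (x - a)) :
    |(∫ x in a..q, 2 * (q - x) * (g x - f x)) - (b - q) ^ 2 * (g q - f q)| ≤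
      M / 4 * (b - a) ^ 4 := by
  have herr : ∀ x ∈ Set.Icc a b, |g x - f x| ≤ M / 8 * (b - a) ^ 2 := fun x hx => by
    rw [hg]
    exact abs_chord_sub_le hab hM hf' hf'' hbd hx
  have hC : 0 ≤ M / 8 * (b - a) ^ 2 := by positivity
  have hint : |∫ x in a..q, 2 * (q - x) * (g x - f x)| ≤
      2 * (b - a) * (M / 8 * (b - a) ^ 2) * (q - a) := by
    have h := norm_integral_le_of_norm_le_const (a := a) (b := q)
      (f := fun x => 2 * (q - x) * (g x - f x)) (C := 2 * (b - a) * (M / 8 * (b - a) ^ 2)) ?_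
    · rwa [Real.norm_eq_abs, abs_of_nonneg (sub_nonneg.2 haq)] at h
    · intro x hx
      rw [Set.uIoc_of_le haq] at hx
      rw [Real.norm_eq_abs, abs_mul, abs_of_nonneg (by linarith [hx.2] : 0 ≤ 2 * (q - x))]
      exact mul_le_mul (by linarith [hx.1]) (herr x ⟨hx.1.le, hx.2.trans hqb⟩) (abs_nonneg _)
        (by linarith)
  have hpt : |(b - q) ^ 2 * (g q - f q)| ≤ (b - q) ^ 2 * (M / 8 * (b - a) ^ 2) := by
    rw [abs_mul, abs_of_nonneg (sq_nonneg _)]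
    exact mul_le_mul_of_nonneg_left (herr q ⟨haq, hqb⟩) (sq_nonneg _)
  have hweight : 2 * (b - a) * (q - a) + (b - q) ^ 2 ≤ 2 * (b - a) ^ 2 := by
    nlinarith [mul_nonneg (sub_nonneg.2 haq) (sub_nonneg.2 hqb)]
  calc _ ≤ _ := abs_sub _ _
    _ ≤ (2 * (b - a) * (q - a) + (b - q) ^ 2) * (M / 8 * (b - a) ^ 2) := by linarith
    _ ≤ 2 * (b - a) ^ 2 * (M / 8 * (b - a) ^ 2) := mul_le_mul_of_nonneg_right hweight hC
    _ = M / 4 * (b - a) ^ 4 := by ring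
end

section
/- Let P be the 5×5 real matrix P = [[1,0,0,0,0],[2/3,0,1/3,0,0],[1/3,0,1/3,0,1/3],[0,0,1/3,0,2/3],[0,0,0,0,1]]. Then the characteristic polynomial of P is X²(X−1)²(X − 1/3); in particular the eigenvalues of P are 1 (with multiplicity 2), 1/3, and 0 (with multiplicity 2), so every eigenvalue λ satisfies |λ| ≤ 1 and the second largest eigenvalue is 1/3. -/
open Polynomial

/-- characteristic polynomial and eigenvalues of the ABEO update matrix
of the ALM quantizer for the uniform source with `K = 3` levels. -/
theorem abeo_uniform_charpoly (P : Matrix (Fin 5) (Fin 5) ℝ)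
    (hP : P = !![1, 0, 0, 0, 0;
                 2/3, 0, 1/3, 0, 0;
                 1/3, 0, 1/3, 0, 1/3;
                 0, 0, 1/3, 0, 2/3;
                 0, 0, 0, 0, 1]) :
    P.charpoly = X ^ 2 * (X - 1) ^ 2 * (X - C (1/3 : ℝ)) ∧
      spectrum ℝ P = {1, 1/3, 0} ∧
      ∀ μ ∈ spectrum ℝ P, |μ| ≤ 1 := by
  have hchar : P.charpoly = X ^ 2 * (X - 1) ^ 2 * (X - C (1/3 : ℝ)) := by
    subst hP
    simp [Matrix.charpoly, Matrix.charmatrix_apply, Matrix.det_succ_row_zero,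
      Fin.sum_univ_succ, Fin.succAbove, Matrix.diagonal_apply]
    ring
  have hspec : spectrum ℝ P = {1, 1/3, 0} := by
    ext μ
    rw [Matrix.mem_spectrum_iff_isRoot_charpoly, hchar]
    simp only [IsRoot.def, eval_mul, eval_pow, eval_sub, eval_X, eval_one, eval_C, mul_eq_zero,
      pow_eq_zero_iff two_ne_zero, sub_eq_zero, Set.mem_insert_iff, Set.mem_singleton_iff]
    grind
  refine ⟨hchar, hspec, fun μ hμ => ?_⟩
  rw [hspec] at hμ
  rcases hμ with rfl | rfl | rfl <;> norm_num [abs_le]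
end

section
/- Let P be the 5×5 real matrix P = [[1,0,0,0,0],[2/3,0,1/3,0,0],[1/3,0,1/3,0,1/3],[0,0,1/3,0,2/3],[0,0,0,0,1]]. Then the fixed-point space {v ∈ ℝ⁵ : P v = v} is exactly the two-dimensional span of the vectors (1,1,1,1,1) and (0, 1/6, 1/2, 5/6, 1); in particular the geometric multiplicity of the eigenvalue 1 is 2, and (0, 1/6, 1/2, 5/6, 1) is the unique fixed vector v of P with v₀ = 0 and v₄ = 1. -/
/-- the fixed-point space of the ABEO update matrix for the uniform source
with `K = 3` levels is the span of `(1,1,1,1,1)` and `(0,1/6,1/2,5/6,1)`; the geometric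
multiplicity of the eigenvalue `1` is `2`, and `(0,1/6,1/2,5/6,1)` is the unique fixed
vector with first entry `0` and last entry `1`. -/
theorem abeo_uniform_fixed_points (P : Matrix (Fin 5) (Fin 5) ℝ)
    (hP : P = !![1, 0, 0, 0, 0;
                 2/3, 0, 1/3, 0, 0;
                 1/3, 0, 1/3, 0, 1/3;
                 0, 0, 1/3, 0, 2/3;
                 0, 0, 0, 0, 1]) :
    (∀ v : Fin 5 → ℝ, P.mulVec v = v ↔
        ∃ s t : ℝ, v = s • ![1, 1, 1, 1, 1] + t • ![0, 1/6, 1/2, 5/6, 1]) ∧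
      LinearIndependent ℝ ![(![1, 1, 1, 1, 1] : Fin 5 → ℝ), ![0, 1/6, 1/2, 5/6, 1]] ∧
      ∀ v : Fin 5 → ℝ, P.mulVec v = v → v 0 = 0 → v 4 = 1 →
        v = ![0, 1/6, 1/2, 5/6, 1] := by
  have key (v : Fin 5 → ℝ) : P.mulVec v = v ↔
      ∃ s t : ℝ, v = s • ![1, 1, 1, 1, 1] + t • ![0, 1/6, 1/2, 5/6, 1] := by
    subst hP
    constructor
    · intro h
      have h₁ := congrFun h 1
      have h₂ := congrFun h 2
      have h₃ := congrFun h 3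
      simp [Matrix.mulVec, dotProduct, Fin.sum_univ_five] at h₁ h₂ h₃
      refine ⟨v 0, v 4 - v 0, ?_⟩
      ext i
      fin_cases i <;> simp <;> linarith
    · rintro ⟨s, t, rfl⟩
      ext i
      fin_cases i <;> simp [Matrix.mulVec, dotProduct, Fin.sum_univ_five] <;> ring
  refine ⟨key, ?_, fun v hv h₀ h₄ => ?_⟩
  · rw [LinearIndependent.pair_iff]
    intro s t h
    have h₀ := congrFun h 0
    have h₄ := congrFun h 4
    simp at h₀ h₄
    exact ⟨h₀, by linarith⟩
  · obtain ⟨s, t, rfl⟩ := (key v).1 hv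
    simp at h₀ h₄
    have ht : t = 1 := by linarith
    simp [h₀, ht]
end

section
/- Let P be the 5×5 real matrix P = [[1,0,0,0,0],[2/3,0,1/3,0,0],[1/3,0,1/3,0,1/3],[0,0,1/3,0,2/3],[0,0,0,0,1]] and let P* be the rank-2 matrix P* = [[1,0,0,0,0],[5/6,0,0,0,1/6],[1/2,0,0,0,1/2],[1/6,0,0,0,5/6],[0,0,0,0,1]]. Then Pⁿ converges to P* as n → ∞, and the convergence is exponentially fast: there exists C > 0 such that for all n, every entry of Pⁿ − P* has absolute value at most C·(1/3)ⁿ. Consequently, for every initialization q ∈ ℝ⁵ with q₀ = 0 and q₄ = 1, the iterates Pⁿ q converge to (0, 1/6, 1/2, 5/6, 1), independently of the middle entries of q. -/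
open Filter

/-- If `A` fixes `L` and scales `A - L` by `r`, then the powers of `A` differ from `L` by a
geometric sequence of multiples of `A - L`. -/
theorem Matrix.pow_succ_sub_eq_smul {m R : Type*} [Fintype m] [DecidableEq m] [CommRing R]
    {A L : Matrix m m R} {r : R} (hL : A * L = L) (hD : A * (A - L) = r • (A - L)) (n : ℕ) :
    A ^ (n + 1) - L = r ^ n • (A - L) := by
  induction n with
  | zero => simp
  | succ n ih =>
    calc A ^ (n + 1 + 1) - L = A * (A ^ (n + 1) - L) := by rw [mul_sub, hL, ← pow_succ']
      _ = r ^ (n + 1) • (A - L) := by rw [ih, Matrix.mul_smul, hD, smul_smul, pow_succ]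

/-- A sequence of real matrices whose entries approach those of `L` at a geometric rate
converges to `L`. -/
theorem Matrix.tendsto_of_abs_sub_le_geometric {m n : Type*} {A : ℕ → Matrix m n ℝ}
    {L : Matrix m n ℝ} {C r : ℝ} (hr₀ : 0 ≤ r) (hr₁ : r < 1)
    (h : ∀ k i j, |(A k - L) i j| ≤ C * r ^ k) : Tendsto A atTop (nhds L) := by
  refine tendsto_pi_nhds.2 fun i => tendsto_pi_nhds.2 fun j => ?_
  refine tendsto_iff_norm_sub_tendsto_zero.2 (squeeze_zero (fun _ => norm_nonneg _)
    (fun k => h k i j) ?_)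
  simpa using (tendsto_pow_atTop_nhds_zero_of_lt_one hr₀ hr₁).const_mul C

/-- the ABEO iteration matrix powers `Pⁿ` converge exponentially fast
(rate `(1/3)ⁿ`) to the rank-2 limit `P*`, and every admissible initialization converges
to the optimal Lloyd-Max levels `(0, 1/6, 1/2, 5/6, 1)` for the uniform source. -/
theorem abeo_uniform_global_convergence (P Pstar : Matrix (Fin 5) (Fin 5) ℝ)
    (hP : P = !![1, 0, 0, 0, 0;
                 2/3, 0, 1/3, 0, 0;
                 1/3, 0, 1/3, 0, 1/3;
                 0, 0, 1/3, 0, 2/3;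
                 0, 0, 0, 0, 1])
    (hPstar : Pstar = !![1, 0, 0, 0, 0;
                         5/6, 0, 0, 0, 1/6;
                         1/2, 0, 0, 0, 1/2;
                         1/6, 0, 0, 0, 5/6;
                         0, 0, 0, 0, 1]) :
    Tendsto (fun n : ℕ => P ^ n) atTop (nhds Pstar) ∧
      (∃ C : ℝ, 0 < C ∧ ∀ (n : ℕ) (i j : Fin 5),
        |(P ^ n - Pstar) i j| ≤ C * (1/3 : ℝ) ^ n) ∧
      ∀ q : Fin 5 → ℝ, q 0 = 0 → q 4 = 1 →
        Tendsto (fun n : ℕ => (P ^ n).mulVec q) atTop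
          (nhds ![0, 1/6, 1/2, 5/6, 1]) := by
  have hL : P * Pstar = Pstar := by
    subst hP hPstar
    ext i j
    fin_cases i <;> fin_cases j <;> simp [Matrix.mul_apply, Fin.sum_univ_five] <;> norm_num
  have hD : P * (P - Pstar) = (1 / 3 : ℝ) • (P - Pstar) := by
    subst hP hPstar
    ext i j
    fin_cases i <;> fin_cases j <;> simp [Matrix.mul_apply, Fin.sum_univ_five] <;> norm_num
  have hbound : ∀ (n : ℕ) (i j : Fin 5), |(P ^ n - Pstar) i j| ≤ 1 * (1 / 3 : ℝ) ^ n := by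
    rintro (_ | n) i j
    · subst hPstar
      fin_cases i <;> fin_cases j <;> simp [abs_le] <;> norm_num
    · have hentry : |(P - Pstar) i j| ≤ 1 / 3 := by
        subst hP hPstar
        fin_cases i <;> fin_cases j <;> simp [abs_le] <;> norm_num
      rw [Matrix.pow_succ_sub_eq_smul hL hD, Matrix.smul_apply, smul_eq_mul, abs_mul,
        abs_of_nonneg (by positivity), one_mul, pow_succ]
      gcongr
  have hlim : Tendsto (fun n : ℕ => P ^ n) atTop (nhds Pstar) :=
    Matrix.tendsto_of_abs_sub_le_geometric (by norm_num) (by norm_num) hbound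
  refine ⟨hlim, ⟨1, one_pos, hbound⟩, fun q h0 h4 => ?_⟩
  have hq : Pstar.mulVec q = ![0, 1/6, 1/2, 5/6, 1] := by
    subst hPstar
    ext i
    fin_cases i <;> simp [Matrix.mulVec, dotProduct, Fin.sum_univ_five, h0, h4]
  rw [← hq]
  exact ((continuous_id.matrix_mulVec continuous_const).tendsto Pstar).comp hlim
end

section
/- Fix ε ∈ (0, 1/2]. For θ = (θ₁, θ₂, θ₃) ∈ ℝ³ define the 5×5 real matrix P(θ) = [[1,0,0,0,0],[θ₁,0,1−θ₁,0,0],[θ₂θ₁,0,(1−θ₁)θ₂+(1−θ₂)θ₃,0,(1−θ₂)(1−θ₃)],[0,0,θ₃,0,1−θ₃],[0,0,0,0,1]]. Let (θ^(i))_{i≥1} be any sequence in ℝ³ with ε ≤ θ_k^(i) ≤ 1−ε for all i and k ∈ {1,2,3}. Then for every L ≥ 1, every entry of the product P(θ^(L))·P(θ^(L−1))⋯P(θ^(1)) lying in one of the three middle columns (columns with index 1, 2, 3, zero-indexed) is nonnegative and at most (1−ε)^L; in particular the middle columns of the product converge to the zero vector as L → ∞. -/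
open Filter

/-- The one-iteration ABEO update matrix `P(θ) = P_even P_odd` for `K = 4`, where each
new quantization level is the convex combination
`q_k ← θ_k q_{k−1} + (1−θ_k) q_{k+1}` of its fixed neighbors (here `θ 0 = θ₁`,
`θ 1 = θ₂`, `θ 2 = θ₃`). -/
noncomputable def abeoMatrix (θ : Fin 3 → ℝ) : Matrix (Fin 5) (Fin 5) ℝ :=
  !![1, 0, 0, 0, 0;
     θ 0, 0, 1 - θ 0, 0, 0;
     θ 1 * θ 0, 0, (1 - θ 0) * θ 1 + (1 - θ 1) * θ 2, 0, (1 - θ 1) * (1 - θ 2);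
     0, 0, θ 2, 0, 1 - θ 2;
     0, 0, 0, 0, 1]

/-- The product `P(θ^(L)) · P(θ^(L−1)) ⋯ P(θ^(1))` of the first `L` ABEO update
matrices (empty product for `L = 0`). -/
noncomputable def abeoProduct (θ : ℕ → Fin 3 → ℝ) : ℕ → Matrix (Fin 5) (Fin 5) ℝ
  | 0 => 1
  | L + 1 => abeoMatrix (θ (L + 1)) * abeoProduct θ L

/-- Multiplying by an ABEO matrix contracts a nonnegative vector vanishing at both reference
coordinates by the factor `1 - ε` and keeps these coordinates zero. -/
theorem abeoMatrix_mulVec_bounds {ε c : ℝ} (hε : 0 < ε) {θ : Fin 3 → ℝ}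
    (hθ : ∀ k, ε ≤ θ k ∧ θ k ≤ 1 - ε) {v : Fin 5 → ℝ} (h0 : v 0 = 0) (h4 : v 4 = 0)
    (hv : ∀ i, 0 ≤ v i ∧ v i ≤ c) :
    (abeoMatrix θ).mulVec v 0 = 0 ∧ (abeoMatrix θ).mulVec v 4 = 0 ∧
      ∀ i, 0 ≤ (abeoMatrix θ).mulVec v i ∧ (abeoMatrix θ).mulVec v i ≤ (1 - ε) * c := by
  obtain ⟨a0, b0⟩ := hθ 0
  obtain ⟨a1, b1⟩ := hθ 1
  obtain ⟨a2, b2⟩ := hθ 2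
  obtain ⟨v0, vc⟩ := hv 2
  have hr : 0 ≤ 1 - ε := by linarith
  have scaled {t : ℝ} (ht : 0 ≤ t) (ht' : t ≤ 1 - ε) : 0 ≤ t * v 2 ∧ t * v 2 ≤ (1 - ε) * c :=
    ⟨mul_nonneg ht v0, mul_le_mul ht' vc v0 hr⟩
  have e0 : (abeoMatrix θ).mulVec v 0 = 0 := by
    simp [abeoMatrix, Matrix.mulVec, dotProduct, Fin.sum_univ_five, h0]
  have e1 : (abeoMatrix θ).mulVec v 1 = (1 - θ 0) * v 2 := by
    simp [abeoMatrix, Matrix.mulVec, dotProduct, Fin.sum_univ_five, h0]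
  have e2 : (abeoMatrix θ).mulVec v 2 = ((1 - θ 0) * θ 1 + (1 - θ 1) * θ 2) * v 2 := by
    simp [abeoMatrix, Matrix.mulVec, dotProduct, Fin.sum_univ_five, h0, h4]
  have e3 : (abeoMatrix θ).mulVec v 3 = θ 2 * v 2 := by
    simp [abeoMatrix, Matrix.mulVec, dotProduct, Fin.sum_univ_five, h4]
  have e4 : (abeoMatrix θ).mulVec v 4 = 0 := by
    simp [abeoMatrix, Matrix.mulVec, dotProduct, Fin.sum_univ_five, h4]
  have hc : 0 ≤ (1 - ε) * c := mul_nonneg hr (v0.trans vc)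
  refine ⟨e0, e4, fun i => ?_⟩
  fin_cases i
  · exact ⟨e0.ge, e0.le.trans hc⟩
  · exact e1 ▸ scaled (by linarith) (by linarith)
  · exact e2 ▸ scaled (by nlinarith) (by nlinarith)
  · exact e3 ▸ scaled (by linarith) (by linarith)
  · exact ⟨e4.ge, e4.le.trans hc⟩

theorem abeoProduct_column_bounds {ε : ℝ} (hε : 0 < ε) {θ : ℕ → Fin 3 → ℝ}
    (hθ : ∀ i : ℕ, 1 ≤ i → ∀ k : Fin 3, ε ≤ θ i k ∧ θ i k ≤ 1 - ε)
    {j : Fin 5} (hj : j = 1 ∨ j = 2 ∨ j = 3) (L : ℕ) :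
    abeoProduct θ L 0 j = 0 ∧ abeoProduct θ L 4 j = 0 ∧
      ∀ i, 0 ≤ abeoProduct θ L i j ∧ abeoProduct θ L i j ≤ (1 - ε) ^ L := by
  induction L with
  | zero =>
    refine ⟨Matrix.one_apply_ne ?_, Matrix.one_apply_ne ?_, fun i => ?_⟩
    · rcases hj with rfl | rfl | rfl <;> decide
    · rcases hj with rfl | rfl | rfl <;> decide
    · rw [abeoProduct, Matrix.one_apply]
      split_ifs <;> norm_num
  | succ L ih =>
    rw [pow_succ']
    exact abeoMatrix_mulVec_bounds hε (hθ (L + 1) L.succ_pos)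
      (v := fun i => abeoProduct θ L i j) ih.1 ih.2.1 ih.2.2

/-- with all coefficients `θ_k^(i) ∈ [ε, 1−ε]`, every entry of the product
`P(θ^(L)) ⋯ P(θ^(1))` lying in one of the three middle columns is nonnegative and at most
`(1−ε)^L`; in particular the middle columns of the product converge to zero. -/
theorem abeo_product_middle_columns_vanish (ε : ℝ) (hε : 0 < ε) (hε' : ε ≤ 1/2)
    (θ : ℕ → Fin 3 → ℝ)
    (hθ : ∀ i : ℕ, 1 ≤ i → ∀ k : Fin 3, ε ≤ θ i k ∧ θ i k ≤ 1 - ε) :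
    (∀ L : ℕ, 1 ≤ L → ∀ i j : Fin 5, j = 1 ∨ j = 2 ∨ j = 3 →
        0 ≤ abeoProduct θ L i j ∧ abeoProduct θ L i j ≤ (1 - ε) ^ L) ∧
      ∀ i j : Fin 5, j = 1 ∨ j = 2 ∨ j = 3 →
        Tendsto (fun L : ℕ => abeoProduct θ L i j) atTop (nhds 0) := by
  have bounds := fun (L : ℕ) (i j : Fin 5) (hj : j = 1 ∨ j = 2 ∨ j = 3) =>
    (abeoProduct_column_bounds hε hθ hj L).2.2 i
  refine ⟨fun L _ => bounds L, fun i j hj => ?_⟩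
  exact squeeze_zero (fun L => (bounds L i j hj).1) (fun L => (bounds L i j hj).2)
    (tendsto_pow_atTop_nhds_zero_of_lt_one (by linarith) (by linarith))
end
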